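/- arXiv:1612.01303 — 2 statements merged into one kernel-verified Lean document; each statement's English description precedes it below -/
import Mathlib

section
/- Let n ≥ 1. For every continuous translation-invariant valuation μ on ℝⁿ there exists a unique family of valuations μ_k^ε (k = 0, …, n, ε ∈ {+,−}) such that μ_k^+ ∈ Val_k^+ and μ_k^− ∈ Val_k^− for each k, and μ = Σ_{k=0}^{n} (μ_k^+ + μ_k^−). (McMullen's decomposition: Val = ⨁_{k,ε} Val_k^ε.) -/
open MeasureTheory Pointwise
open scoped NNReal ENNReal

noncomputable section

/-- Euclidean `n`-space `ℝⁿ`. -/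
abbrev Eucl (n : ℕ) : Type := EuclideanSpace ℝ (Fin n)

section Generic

variable {V : Type*} [NormedAddCommGroup V] [NormedSpace ℝ V]

/-- `μ` is a valuation: whenever the union of two convex bodies `K`, `L` is again a convex
body `M` (with intersection the convex body `I`), one has `μ M + μ I = μ K + μ L`. -/
def IsValuation (μ : ConvexBody V → ℝ) : Prop :=
  ∀ K L M I : ConvexBody V,
    (M : Set V) = (K : Set V) ∪ (L : Set V) → (I : Set V) = (K : Set V) ∩ (L : Set V) →
      μ M + μ I = μ K + μ L

/-- The translate `K + x` of a convex body. -/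
def ConvexBody.translate (K : ConvexBody V) (x : V) : ConvexBody V :=
  ⟨(K : Set V) + {x}, K.convex.add (convex_singleton x),
    K.isCompact.add isCompact_singleton, K.nonempty.add (Set.singleton_nonempty x)⟩

/-- Translation invariance of a valuation. -/
def TransInv (μ : ConvexBody V → ℝ) : Prop :=
  ∀ (K : ConvexBody V) (x : V), μ (K.translate x) = μ K

/-- The dilate `t • K` of a convex body. -/
def ConvexBody.dilate (t : ℝ) (K : ConvexBody V) : ConvexBody V :=
  ⟨t • (K : Set V), K.convex.smul t, K.isCompact.smul t, K.nonempty.smul_set⟩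

/-- Homogeneity of degree `k` of a valuation: `μ (t • K) = t ^ k * μ K` for `t > 0`. -/
def Homog (k : ℕ) (μ : ConvexBody V → ℝ) : Prop :=
  ∀ (K : ConvexBody V) (t : ℝ), 0 < t → μ (ConvexBody.dilate t K) = t ^ k * μ K

/-- The reflection `-K` of a convex body. -/
def ConvexBody.reflect (K : ConvexBody V) : ConvexBody V :=
  ⟨-(K : Set V), K.convex.neg, K.isCompact.neg, K.nonempty.neg⟩

/-- Even valuations: `μ (-K) = μ K`. -/
def EvenVal (μ : ConvexBody V → ℝ) : Prop := ∀ K : ConvexBody V, μ K.reflect = μ K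

/-- Odd valuations: `μ (-K) = -μ K`. -/
def OddVal (μ : ConvexBody V → ℝ) : Prop := ∀ K : ConvexBody V, μ K.reflect = -μ K

end Generic

namespace ConvexBody

variable {V : Type*} [NormedAddCommGroup V] [NormedSpace ℝ V]

theorem dilate_eq_smul (t : ℝ) (K : ConvexBody V) : dilate t K = t • K := rfl

theorem coe_translate (K : ConvexBody V) (x : V) : (K.translate x : Set V) = (K : Set V) + {x} :=
  rfl

theorem coe_reflect (K : ConvexBody V) : (K.reflect : Set V) = -(K : Set V) := rfl

theorem reflect_eq_smul (K : ConvexBody V) : K.reflect = (-1 : ℝ) • K :=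
  ConvexBody.ext (by rw [coe_reflect, coe_smul, ← Set.image_neg_eq_neg, ← Set.image_smul]; simp)

theorem reflect_reflect (K : ConvexBody V) : K.reflect.reflect = K :=
  ConvexBody.ext (by simp [coe_reflect])

theorem smul_translate (t : ℝ) (K : ConvexBody V) (x : V) :
    t • K.translate x = (t • K).translate (t • x) :=
  ConvexBody.ext (by simp only [coe_smul, coe_translate, smul_add, Set.smul_set_singleton])

theorem translate_add (K L : ConvexBody V) (x : V) :
    K.translate x + L = (K + L).translate x :=
  ConvexBody.ext (by simp only [coe_add, coe_translate, add_right_comm])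

theorem dist_smul_smul_le (t : ℝ) (K L : ConvexBody V) :
    dist (t • K) (t • L) ≤ |t| * dist K L := by
  refine le_of_forall_pos_le_add fun ε hε => ?_
  have key : ∀ K L : ConvexBody V, ∀ x ∈ ((t • K : ConvexBody V) : Set V),
      ∃ y ∈ ((t • L : ConvexBody V) : Set V), dist x y ≤ |t| * dist K L + ε := by
    rintro K L _ ⟨x, hx, rfl⟩
    obtain ⟨y, hy, hxy⟩ := Metric.exists_dist_lt_of_hausdorffDist_lt (s := (K : Set V))
      (t := (L : Set V)) hx (r := dist K L + ε / (|t| + 1))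
      (by
        rw [hausdorffDist_coe]
        linarith [show 0 < ε / (|t| + 1) by positivity])
      hausdorffEDist_ne_top
    refine ⟨t • y, ⟨y, hy, rfl⟩, ?_⟩
    simp only [dist_smul₀, Real.norm_eq_abs]
    calc |t| * dist x y ≤ |t| * (dist K L + ε / (|t| + 1)) := by gcongr
      _ = |t| * dist K L + |t| / (|t| + 1) * ε := by ring
      _ ≤ |t| * dist K L + 1 * ε := by
        gcongr
        exact div_le_one_of_le₀ (by linarith) (by positivity)
      _ = _ := by ring
  rw [← hausdorffDist_coe]
  refine Metric.hausdorffDist_le_of_mem_dist (by positivity) (key K L) fun x hx => ?_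
  rw [dist_comm K L]
  exact key L K x hx

theorem continuous_const_smul (t : ℝ) : Continuous fun K : ConvexBody V => t • K :=
  (LipschitzWith.of_dist_le_mul (K := |t|.toNNReal) fun K L => by
    simpa using dist_smul_smul_le t K L).continuous

theorem continuous_smul_const (K : ConvexBody V) : Continuous fun t : ℝ => t • K := by
  obtain ⟨C, hC, hK⟩ := K.isBounded.exists_pos_norm_le
  refine (LipschitzWith.of_dist_le_mul (K := C.toNNReal) fun s t => ?_).continuous
  have key : ∀ s t : ℝ, ∀ x ∈ ((s • K : ConvexBody V) : Set V),
      ∃ y ∈ ((t • K : ConvexBody V) : Set V), dist x y ≤ C * dist s t := by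
    rintro s t _ ⟨x, hx, rfl⟩
    refine ⟨t • x, ⟨x, hx, rfl⟩, ?_⟩
    simp only [dist_eq_norm, ← sub_smul, norm_smul]
    rw [mul_comm]
    gcongr
    exact hK x hx
  rw [Real.coe_toNNReal _ hC.le, ← hausdorffDist_coe]
  refine Metric.hausdorffDist_le_of_mem_dist (by positivity) (key s t) fun x hx => ?_
  rw [dist_comm s t]
  exact key t s x hx

end ConvexBody

section Valuation

variable {V : Type*} [NormedAddCommGroup V] [NormedSpace ℝ V] {μ ν : ConvexBody V → ℝ}

theorem IsValuation.comp_smul (hμ : IsValuation μ) {t : ℝ} (ht : t ≠ 0) :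
    IsValuation fun K => μ (t • K) := by
  intro K L M I hM hI
  apply hμ
  · simp only [ConvexBody.coe_smul, hM, Set.smul_set_union]
  · simp only [ConvexBody.coe_smul, hI, Set.smul_set_inter₀ ht]

theorem TransInv.comp_smul (hμ : TransInv μ) (t : ℝ) : TransInv fun K => μ (t • K) := by
  intro K x
  simp only [ConvexBody.smul_translate, hμ _ _]

theorem IsValuation.add (hμ : IsValuation μ) (hν : IsValuation ν) :
    IsValuation fun K => μ K + ν K := fun K L M I hM hI => by
  linarith [hμ K L M I hM hI, hν K L M I hM hI]

theorem IsValuation.const_mul (hμ : IsValuation μ) (c : ℝ) :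
    IsValuation fun K => c * μ K := fun K L M I hM hI => by
  linear_combination c * hμ K L M I hM hI

theorem IsValuation.sum {ι : Type*} {s : Finset ι} {μ : ι → ConvexBody V → ℝ}
    (hμ : ∀ i ∈ s, IsValuation (μ i)) : IsValuation fun K => ∑ i ∈ s, μ i K := by
  intro K L M I hM hI
  simp only [← Finset.sum_add_distrib]
  exact Finset.sum_congr rfl fun i hi => hμ i hi K L M I hM hI

/-- A segment joining two closed sets inside their union meets their intersection. -/
theorem exists_mem_segment_mem_inter {K L : Set V} (hK : IsClosed K) (hL : IsClosed L)
    (hKL : Convex ℝ (K ∪ L)) {x y : V} (hx : x ∈ K) (hy : y ∈ L) :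
    ∃ z ∈ segment ℝ x y, z ∈ K ∩ L :=
  isPreconnected_closed_iff.1 (convex_segment x y).isPreconnected K L hK hL
    (hKL.segment_subset (Or.inl hx) (Or.inr hy))
    ⟨x, left_mem_segment ℝ x y, hx⟩ ⟨y, right_mem_segment ℝ x y, hy⟩

theorem inter_add_eq {K L P : Set V} (hK : IsClosed K) (hL : IsClosed L)
    (hKL : Convex ℝ (K ∪ L)) (hP : Convex ℝ P) :
    K ∩ L + P = (K + P) ∩ (L + P) := by
  refine Set.Subset.antisymm (Set.subset_inter (Set.add_subset_add_right Set.inter_subset_left)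
    (Set.add_subset_add_right Set.inter_subset_right)) ?_
  rintro _ ⟨⟨x, hx, p, hp, rfl⟩, ⟨y, hy, q, hq, hxy⟩⟩
  obtain ⟨z, ⟨a, b, ha, hb, hab, rfl⟩, hz⟩ := exists_mem_segment_mem_inter hK hL hKL hx hy
  refine ⟨_, hz, _, hP hp hq ha hb hab, ?_⟩
  simp only at hxy ⊢
  calc a • x + b • y + (a • p + b • q) = a • (x + p) + b • (y + q) := by module
    _ = x + p := by rw [hxy, ← add_smul, hab, one_smul]

theorem IsValuation.comp_add (hμ : IsValuation μ) (P : ConvexBody V) :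
    IsValuation fun K => μ (K + P) := by
  intro K L M I hM hI
  apply hμ
  · simp only [ConvexBody.coe_add, hM, Set.union_add]
  · simp only [ConvexBody.coe_add, hI]
    exact inter_add_eq K.isClosed L.isClosed (hM ▸ M.convex) P.convex

theorem TransInv.comp_add (hμ : TransInv μ) (P : ConvexBody V) :
    TransInv fun K => μ (K + P) := by
  intro K x
  simp only [ConvexBody.translate_add, hμ _ _]

end Valuation

namespace ConvexBody

variable {V : Type*} [NormedAddCommGroup V] [NormedSpace ℝ V]

/-- The union of the segments joining `0` to the points of a convex body. -/
def cone (K : ConvexBody V) : ConvexBody V where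
  carrier := (fun p : ℝ × V => p.1 • p.2) '' (Set.Icc 0 1 ×ˢ (K : Set V))
  convex' := by
    have h : (fun p : ℝ × V => p.1 • p.2) '' (Set.Icc 0 1 ×ˢ (K : Set V)) =
        convexJoin ℝ {0} (K : Set V) := by
      ext x
      simp only [convexJoin_singleton_left, Set.mem_iUnion, segment_eq_image, Set.mem_image,
        Prod.exists, Set.mem_prod, smul_zero, zero_add, exists_prop]
      grind
    exact h ▸ (convex_singleton (0 : V)).convexJoin K.convex
  isCompact' := (isCompact_Icc.prod K.isCompact).image (by fun_prop)
  nonempty' := ((Set.nonempty_Icc.2 zero_le_one).prod K.nonempty).image _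

theorem mem_cone {K : ConvexBody V} {x : V} :
    x ∈ (K.cone : Set V) ↔ ∃ t : ℝ, 0 ≤ t ∧ t ≤ 1 ∧ x ∈ t • (K : Set V) := by
  change x ∈ (fun p : ℝ × V => p.1 • p.2) '' (Set.Icc 0 1 ×ˢ (K : Set V)) ↔ _
  simp only [Set.mem_image, Prod.exists, Set.mem_prod, Set.mem_Icc, Set.mem_smul_set]
  grind

theorem mem_smul_cone {K : ConvexBody V} {x : V} {r : ℝ} (hr : 0 < r) :
    x ∈ ((r • K.cone : ConvexBody V) : Set V) ↔
      ∃ t : ℝ, 0 ≤ t ∧ t ≤ r ∧ x ∈ t • (K : Set V) := by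
  rw [coe_smul, Set.mem_smul_set_iff_inv_smul_mem₀ hr.ne', mem_cone]
  constructor
  · rintro ⟨t, h0, h1, h⟩
    refine ⟨r * t, by positivity, by nlinarith, ?_⟩
    rw [mul_smul]
    exact (Set.mem_smul_set_iff_inv_smul_mem₀ hr.ne' _ _).2 h
  · rintro ⟨t, h0, h1, h⟩
    refine ⟨r⁻¹ * t, by positivity, by rwa [inv_mul_le_iff₀ hr, mul_one], ?_⟩
    rw [mul_smul]
    exact Set.smul_mem_smul_set h

theorem mem_smul_add_cone {K : ConvexBody V} {x : V} {r : ℝ} (hr : 0 < r) :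
    x ∈ ((r • K + K.cone : ConvexBody V) : Set V) ↔
      ∃ t : ℝ, r ≤ t ∧ t ≤ r + 1 ∧ x ∈ t • (K : Set V) := by
  rw [coe_add, Set.mem_add]
  constructor
  · rintro ⟨y, hy, z, hz, rfl⟩
    obtain ⟨t, h0, h1, h⟩ := mem_cone.1 hz
    refine ⟨r + t, by linarith, by linarith, ?_⟩
    rw [K.convex.add_smul hr.le h0]
    exact Set.add_mem_add hy h
  · rintro ⟨t, h0, h1, h⟩
    have : t = r + (t - r) := by ring
    rw [this, K.convex.add_smul hr.le (by linarith)] at h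
    obtain ⟨y, hy, z, hz, rfl⟩ := h
    exact ⟨y, hy, z, mem_cone.2 ⟨t - r, by linarith, by linarith, hz⟩, rfl⟩

theorem coe_add_one_smul_cone (K : ConvexBody V) {r : ℝ} (hr : 0 < r) :
    (((r + 1) • K.cone : ConvexBody V) : Set V) =
      ((r • K.cone : ConvexBody V) : Set V) ∪ ((r • K + K.cone : ConvexBody V) : Set V) := by
  ext x
  rw [Set.mem_union, mem_smul_cone hr, mem_smul_cone (by linarith), mem_smul_add_cone hr]
  constructor
  · rintro ⟨t, h0, h1, h⟩
    rcases le_total t r with h2 | h2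
    · exact Or.inl ⟨t, h0, h2, h⟩
    · exact Or.inr ⟨t, h2, h1, h⟩
  · rintro (⟨t, h0, h1, h⟩ | ⟨t, h0, h1, h⟩)
    · exact ⟨t, h0, by linarith, h⟩
    · exact ⟨t, by linarith, h1, h⟩

theorem coe_smul_eq_inter_cone (K : ConvexBody V) {r : ℝ} (hr : 0 < r) :
    ((r • K : ConvexBody V) : Set V) =
      ((r • K.cone : ConvexBody V) : Set V) ∩ ((r • K + K.cone : ConvexBody V) : Set V) := by
  ext x
  rw [Set.mem_inter_iff, mem_smul_cone hr, mem_smul_add_cone hr, coe_smul]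
  constructor
  · exact fun h => ⟨⟨r, hr.le, le_rfl, h⟩, ⟨r, le_rfl, by linarith, h⟩⟩
  · rintro ⟨⟨t, ht0, htr, y, hy, rfl⟩, ⟨s, hrs, -, z, hz, hzy⟩⟩
    have hs : 0 < s := hr.trans_le hrs
    simp only at hzy ⊢
    rcases hrs.eq_or_lt with rfl | hrs
    · exact hzy ▸ Set.smul_mem_smul_set hz
    have hst : 0 < s - t := by linarith
    rw [Set.mem_smul_set_iff_inv_smul_mem₀ hr.ne']
    have hx : r⁻¹ • t • y =
        (t * (s - r) / (r * (s - t))) • y + (s * (r - t) / (r * (s - t))) • z := by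
      have h1 : (s * (r - t) / (r * (s - t))) • z = ((r - t) / (r * (s - t)) * t) • y := by
        rw [mul_smul, ← hzy, smul_smul]
        congr 1
        ring
      rw [h1, smul_smul, ← add_smul]
      congr 1
      field_simp
      ring
    rw [hx]
    refine K.convex hy hz (div_nonneg (mul_nonneg ht0 (by linarith)) (by positivity))
      (div_nonneg (mul_nonneg hs.le (by linarith)) (by positivity)) ?_
    field_simp
    ring

theorem eq_translate_cone {K L : ConvexBody V} {a : V} {s : Set V} (hs : s.Nonempty)
    (hL : (L : Set V) = convexHull ℝ s) (hK : (K : Set V) = convexHull ℝ (insert a s)) :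
    K = (L.translate (-a)).cone.translate a := by
  ext x
  rw [hK, convexHull_insert hs, ← hL, coe_translate, Set.mem_add]
  simp only [convexJoin_singleton_left, Set.mem_iUnion, segment_eq_image, Set.mem_image,
    mem_cone, Set.mem_smul_set, coe_translate, Set.mem_add, Set.mem_singleton_iff, Set.mem_Icc]
  constructor
  · rintro ⟨y, hy, t, ⟨h0, h1⟩, rfl⟩
    exact ⟨t • (y + -a), ⟨t, h0, h1, _, ⟨y, hy, _, rfl, rfl⟩, rfl⟩, a, rfl, by module⟩
  · rintro ⟨_, ⟨t, h0, h1, _, ⟨y, hy, _, rfl, rfl⟩, rfl⟩, _, rfl, rfl⟩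
    exact ⟨y, hy, t, ⟨h0, h1⟩, by module⟩

end ConvexBody

section Polynomiality

variable {V : Type*} [NormedAddCommGroup V] [NormedSpace ℝ V]

theorem IsValuation.smul_cone {μ : ConvexBody V → ℝ} (hμ : IsValuation μ) (K : ConvexBody V)
    {r : ℝ} (hr : 0 < r) :
    μ ((r + 1) • K.cone) - μ (r • K.cone) = μ (r • K + K.cone) - μ (r • K) := by
  linarith [hμ _ _ _ _ (K.coe_add_one_smul_cone hr) (K.coe_smul_eq_inter_cone hr)]

theorem fwdDiff_iter_eq_zero_of_le {f : ℕ → ℝ} {N k : ℕ} (hf : (fwdDiff 1)^[N] f = 0)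
    (hk : N ≤ k) : (fwdDiff 1)^[k] f = 0 := by
  obtain ⟨j, rfl⟩ := Nat.exists_eq_add_of_le' hk
  rw [Function.iterate_add_apply, hf]
  exact Function.iterate_fixed (fwdDiff_const 1 (0 : ℝ)) j

/-- Along the integral dilates of a polytope, a translation invariant valuation has a vanishing
iterated difference. -/
theorem IsValuation.exists_fwdDiff_iter_eq_zero {s : Set V} (hs : s.Finite) :
    ∀ {μ : ConvexBody V → ℝ}, IsValuation μ → TransInv μ → ∀ K : ConvexBody V,
      (K : Set V) = convexHull ℝ s →
      ∃ N : ℕ, (fwdDiff 1)^[N] (fun l : ℕ => μ (((l : ℝ) + 1) • K)) = 0 := by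
  induction s, hs using Set.Finite.induction_on with
  | empty =>
    intro μ _ _ K hK
    exact absurd K.nonempty (by simp [hK])
  | @insert a s _ hs ih =>
    intro μ hμ ht K hK
    rcases s.eq_empty_or_nonempty with rfl | hne
    · refine ⟨1, funext fun l => ?_⟩
      have hr : ∀ r : ℝ, μ (r • K) = μ 0 := by
        intro r
        rw [← ht 0 (r • a)]
        congr 1
        ext x
        simp [hK, ConvexBody.coe_translate, Set.smul_set_singleton]
      simp [fwdDiff, hr]
    · let L : ConvexBody V := ⟨convexHull ℝ s, convex_convexHull ℝ s,
        hs.isCompact_convexHull (𝕜 := ℝ), hne.convexHull⟩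
      set L' := L.translate (-a)
      obtain ⟨N, hN⟩ := ih hμ ht L rfl
      obtain ⟨N', hN'⟩ := ih (hμ.comp_add L'.cone) (ht.comp_add L'.cone) L rfl
      refine ⟨max N N' + 1, ?_⟩
      have hf : fwdDiff 1 (fun l : ℕ => μ (((l : ℝ) + 1) • K)) =
          (fun l : ℕ => μ (((l : ℝ) + 1) • L + L'.cone)) +
            (-1 : ℝ) • fun l : ℕ => μ (((l : ℝ) + 1) • L) := by
        funext l
        have h := hμ.smul_cone L' (r := (l : ℝ) + 1) (by positivity)
        rw [ConvexBody.smul_translate, ConvexBody.translate_add, ht _ _, ht _ _] at h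
        simp only [fwdDiff, ConvexBody.eq_translate_cone hne (L := L) rfl hK,
          ConvexBody.smul_translate, ht _ _, Nat.cast_add, Nat.cast_one, Pi.add_apply,
          Pi.smul_apply, smul_eq_mul]
        linarith
      rw [Function.iterate_succ_apply, hf, fwdDiff_iter_add, fwdDiff_iter_const_smul,
        fwdDiff_iter_eq_zero_of_le hN (le_max_left _ _),
        fwdDiff_iter_eq_zero_of_le hN' (le_max_right _ _), smul_zero, add_zero]

theorem exists_polynomial_of_fwdDiff_iter_eq_zero {f : ℕ → ℝ} {N : ℕ}
    (hf : (fwdDiff 1)^[N] f = 0) : ∃ p : Polynomial ℝ, ∀ l : ℕ, f l = p.eval (l : ℝ) := by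
  refine ⟨∑ k ∈ Finset.range N, Polynomial.C ((fwdDiff 1)^[k] f 0 / k.factorial) *
    descPochhammer ℝ k, fun l => ?_⟩
  have h := shift_eq_sum_fwdDiff_iter 1 f l 0
  rw [zero_add, smul_eq_mul, mul_one] at h
  have h1 : ∀ M, l + 1 ≤ M → f l = ∑ k ∈ Finset.range M, l.choose k • (fwdDiff 1)^[k] f 0 := by
    intro M hM
    rw [h]
    refine Finset.sum_subset (Finset.range_mono hM) fun k _ hk => ?_
    rw [Nat.choose_eq_zero_of_lt (by simpa using hk), zero_smul]
  rw [h1 _ (le_max_left (l + 1) N), Polynomial.eval_finsetSum]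
  symm
  refine (Finset.sum_subset (Finset.range_mono (le_max_right (l + 1) N)) fun k _ hk => ?_).trans
    (Finset.sum_congr rfl fun k _ => ?_)
  · simp [fwdDiff_iter_eq_zero_of_le hf (show N ≤ k by simpa using hk)]
  · rw [Polynomial.eval_mul, Polynomial.eval_C, descPochhammer_eval_eq_descFactorial,
      Nat.descFactorial_eq_factorial_mul_choose, nsmul_eq_mul, Nat.cast_mul]
    have : (k.factorial : ℝ) ≠ 0 := by positivity
    field_simp

end Polynomiality

section Bound

theorem exists_forall_subset_closedBall_abs_le {V : Type*} [NormedAddCommGroup V]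
    [NormedSpace ℝ V] [ProperSpace V] {μ : ConvexBody V → ℝ} (hμ : Continuous μ) (r : ℝ) :
    ∃ C, ∀ K : ConvexBody V, (K : Set V) ⊆ Metric.closedBall 0 r → |μ K| ≤ C := by
  let X := Metric.closedBall (0 : V) r
  have : CompactSpace X := isCompact_iff_compactSpace.1 (isCompact_closedBall 0 r)
  let S : Set (TopologicalSpace.NonemptyCompacts X) :=
    {A | Convex ℝ ((fun x : X => (x : V)) '' (A : Set X))}
  let φ : S → ConvexBody V := fun A =>
    ⟨_, A.2, A.1.isCompact.image continuous_subtype_val, A.1.nonempty.image _⟩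
  have hφ : Isometry φ := Isometry.of_dist_eq fun A B =>
    Metric.hausdorffDist_image isometry_subtype_coe
  have hS : IsClosed S := by
    refine isClosed_of_closure_subset fun A hA => ?_
    rw [Metric.mem_closure_iff] at hA
    have hAc : IsClosed ((fun x : X => (x : V)) '' (A : Set X)) :=
      (A.isCompact.image continuous_subtype_val).isClosed
    rintro _ ⟨x, hx, rfl⟩ _ ⟨y, hy, rfl⟩ a b ha hb hab
    rw [← hAc.closure_eq, Metric.mem_closure_iff]
    intro ε hε
    obtain ⟨B, hB, hAB⟩ := hA (ε / 2) (by positivity)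
    have hne : Metric.hausdorffEDist (A : Set X) (B : Set X) ≠ ⊤ :=
      Metric.hausdorffEDist_ne_top_of_nonempty_of_bounded A.nonempty B.nonempty
        A.isCompact.isBounded B.isCompact.isBounded
    obtain ⟨x', hx', hxx⟩ := Metric.exists_dist_lt_of_hausdorffDist_lt hx hAB hne
    obtain ⟨y', hy', hyy⟩ := Metric.exists_dist_lt_of_hausdorffDist_lt hy hAB hne
    obtain ⟨z, hz, hzB⟩ : a • (x' : V) + b • (y' : V) ∈ (fun x : X => (x : V)) '' (B : Set X) :=
      hB ⟨x', hx', rfl⟩ ⟨y', hy', rfl⟩ ha hb hab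
    obtain ⟨w, hw, hwz⟩ := Metric.exists_dist_lt_of_hausdorffDist_lt' hz hAB hne
    refine ⟨w, ⟨w, hw, rfl⟩, ?_⟩
    simp only at hzB ⊢
    have h1 : dist (a • (x : V) + b • (y : V)) z ≤ a * dist x x' + b * dist y y' := by
      rw [hzB]
      refine (dist_add_add_le _ _ _ _).trans_eq ?_
      rw [dist_smul₀, dist_smul₀, Real.norm_of_nonneg ha, Real.norm_of_nonneg hb]
      rfl
    have h2 : a * dist x x' + b * dist y y' ≤ a * (ε / 2) + b * (ε / 2) := by gcongr
    have h3 : dist (z : V) (w : V) < ε / 2 := by rw [dist_comm]; exact hwz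
    calc _ ≤ dist (a • (x : V) + b • (y : V)) z + dist (z : V) w := dist_triangle _ _ _
      _ < (a + b) * (ε / 2) + ε / 2 := by linarith
      _ = ε := by rw [hab]; ring
  have : CompactSpace S := isCompact_iff_compactSpace.1 hS.isCompact
  obtain ⟨C, hC⟩ := (isCompact_range (hμ.comp hφ.continuous)).isBounded.exists_norm_le
  refine ⟨C, fun K hK => ?_⟩
  have hKX : (fun x : X => (x : V)) '' ((fun x : X => (x : V)) ⁻¹' (K : Set V)) = K := by
    rw [Subtype.image_preimage_coe, Set.inter_eq_right.2 hK]
  let A : TopologicalSpace.NonemptyCompacts X :=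
    ⟨⟨(fun x : X => (x : V)) ⁻¹' (K : Set V),
      (K.isClosed.preimage continuous_subtype_val).isCompact⟩,
      Set.image_nonempty.1 (hKX ▸ K.nonempty)⟩
  have hA : A ∈ S := by
    change Convex ℝ ((fun x : X => (x : V)) '' ((fun x : X => (x : V)) ⁻¹' (K : Set V)))
    exact hKX.symm ▸ K.convex
  have hKA : φ ⟨A, hA⟩ = K := ConvexBody.ext hKX
  simpa [hKA] using hC _ ⟨⟨A, hA⟩, rfl⟩

variable {V : Type*} [NormedAddCommGroup V] [NormedSpace ℝ V]

/-- Cutting a body of width at most `M` into slices of width at most `1`. -/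
theorem IsValuation.abs_le_of_width_le {μ : ConvexBody V → ℝ} (hμ : IsValuation μ)
    (f : V →L[ℝ] ℝ) {B : ℝ} (hB : 0 ≤ B) :
    ∀ (M : ℕ) (K : ConvexBody V) (a : ℝ), 1 ≤ M → (∀ x ∈ K, f x ∈ Set.Icc a (a + M)) →
      (∀ L : ConvexBody V, (L : Set V) ⊆ K → (∃ b, ∀ x ∈ L, f x ∈ Set.Icc b (b + 1)) →
        |μ L| ≤ B) → |μ K| ≤ 2 * M * B := by
  intro M K a hM
  induction M, hM using Nat.le_induction generalizing K with
  | base =>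
    intro hK h
    have := h K subset_rfl ⟨a, by simpa using hK⟩
    push_cast
    linarith
  | succ M hM ih =>
    intro hK h
    set c := a + M
    have hcl : IsClosed {x : V | f x ≤ c} := isClosed_le f.continuous continuous_const
    have hcg : IsClosed {x : V | c ≤ f x} := isClosed_le continuous_const f.continuous
    have hvl : Convex ℝ {x : V | f x ≤ c} := convex_halfSpace_le f.isLinear c
    have hvg : Convex ℝ {x : V | c ≤ f x} := convex_halfSpace_ge f.isLinear c
    have hM0 : (0 : ℝ) ≤ M * B := by positivity
    push_cast at hK ⊢
    by_cases hl : ((K : Set V) ∩ {x | f x ≤ c}).Nonempty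
    · by_cases hg : ((K : Set V) ∩ {x | c ≤ f x}).Nonempty
      · have hun : (K : Set V) =
            ((K : Set V) ∩ {x | f x ≤ c}) ∪ ((K : Set V) ∩ {x | c ≤ f x}) := by
          rw [← Set.inter_union_distrib_left, eq_comm, Set.inter_eq_left]
          exact fun x _ => le_total (f x) c
        have hi : (((K : Set V) ∩ {x | f x ≤ c}) ∩ ((K : Set V) ∩ {x | c ≤ f x})).Nonempty := by
          obtain ⟨x, hx⟩ := hl
          obtain ⟨y, hy⟩ := hg
          obtain ⟨z, -, hz⟩ := exists_mem_segment_mem_inter (K.isClosed.inter hcl)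
            (K.isClosed.inter hcg) (hun ▸ K.convex) hx hy
          exact ⟨z, hz⟩
        let L : ConvexBody V := ⟨_, K.convex.inter hvl, K.isCompact.inter_right hcl, hl⟩
        let G : ConvexBody V := ⟨_, K.convex.inter hvg, K.isCompact.inter_right hcg, hg⟩
        let I : ConvexBody V := ⟨_, L.convex.inter G.convex, L.isCompact.inter G.isCompact, hi⟩
        have hLK : (L : Set V) ⊆ K := Set.inter_subset_left
        have hGK : (G : Set V) ⊆ K := Set.inter_subset_left
        have hIL : (I : Set V) ⊆ L := Set.inter_subset_left
        have hval : μ K + μ I = μ L + μ G := hμ L G K I hun rfl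
        have h1 : |μ L| ≤ 2 * M * B :=
          ih L (fun x hx => ⟨(hK x hx.1).1, hx.2⟩) fun L' hL' => h L' (hL'.trans hLK)
        have h2 : |μ G| ≤ B := h G hGK ⟨c, fun x hx => ⟨hx.2, by linarith [(hK x hx.1).2]⟩⟩
        have h3 : |μ I| ≤ B := h I (hIL.trans hLK)
          ⟨c, fun x hx => ⟨hx.2.2, by linarith [(hK x hx.2.1).2]⟩⟩
        rw [abs_le] at *
        constructor <;> nlinarith
      · have := ih K (fun x hx => ⟨(hK x hx).1, le_of_not_ge fun hx' => hg ⟨x, hx, hx'⟩⟩) h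
        linarith
    · have := h K subset_rfl ⟨c, fun x hx => ⟨le_of_not_ge fun hx' => hl ⟨x, hx, hx'⟩,
        by linarith [(hK x hx).2]⟩⟩
      linarith

theorem IsValuation.abs_le_of_coord_width_le {n : ℕ} {μ : ConvexBody (Eucl n) → ℝ}
    (hμ : IsValuation μ) {C : ℝ} (hC : 0 ≤ C)
    (h : ∀ K : ConvexBody (Eucl n), (∀ i, ∃ a, ∀ x ∈ K, x i ∈ Set.Icc a (a + 1)) → |μ K| ≤ C)
    {M : ℕ} (hM : 1 ≤ M) (s : Finset (Fin n)) :
    ∀ K : ConvexBody (Eucl n), (∀ i ∈ s, ∃ a : ℝ, ∀ x ∈ K, x i ∈ Set.Icc a (a + M)) →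
      (∀ i ∉ s, ∃ a, ∀ x ∈ K, x i ∈ Set.Icc a (a + 1)) → |μ K| ≤ (2 * M) ^ s.card * C := by
  induction s using Finset.induction_on with
  | empty =>
    intro K _ hK
    simpa using h K fun i => hK i (Finset.notMem_empty i)
  | insert i s hi ih =>
    intro K hK hK'
    obtain ⟨a, ha⟩ := hK i (Finset.mem_insert_self i s)
    rw [Finset.card_insert_of_notMem hi, pow_succ', mul_assoc]
    refine hμ.abs_le_of_width_le (EuclideanSpace.proj i) (by positivity) M K a hM ha
      fun L hLK hL => ih L (fun j hj => ?_) fun j hj => ?_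
    · obtain ⟨b, hb⟩ := hK j (Finset.mem_insert_of_mem hj)
      exact ⟨b, fun x hx => hb x (hLK hx)⟩
    · rcases eq_or_ne j i with rfl | hji
      · exact hL
      · obtain ⟨b, hb⟩ := hK' j (by simp [hji, hj])
        exact ⟨b, fun x hx => hb x (hLK hx)⟩

theorem IsValuation.exists_abs_smul_le {n : ℕ} {μ : ConvexBody (Eucl n) → ℝ}
    (hμ : IsValuation μ) (hcont : Continuous μ) (ht : TransInv μ) (K : ConvexBody (Eucl n)) :
    ∃ C, ∀ l : ℕ, |μ (((l : ℝ) + 1) • K)| ≤ C * ((l : ℝ) + 1) ^ n := by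
  obtain ⟨C, hC⟩ := exists_forall_subset_closedBall_abs_le hcont (√n)
  have h : ∀ K : ConvexBody (Eucl n), (∀ i, ∃ a, ∀ x ∈ K, x i ∈ Set.Icc a (a + 1)) →
      |μ K| ≤ C := by
    intro K hK
    choose a ha using hK
    rw [← ht K (-WithLp.toLp 2 a)]
    refine hC _ ?_
    rintro _ ⟨x, hx, _, rfl, rfl⟩
    rw [mem_closedBall_zero_iff, EuclideanSpace.norm_eq]
    refine Real.sqrt_le_sqrt ((Finset.sum_le_card_nsmul _ _ 1 fun i _ => ?_).trans_eq (by simp))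
    have := ha i x hx
    rw [Real.norm_eq_abs, sq_abs]
    simp only [PiLp.add_apply, PiLp.neg_apply]
    rw [Set.mem_Icc] at this
    nlinarith
  have hC0 : 0 ≤ C := (abs_nonneg (μ 0)).trans (hC 0 (by simp [ConvexBody.coe_zero]))
  obtain ⟨R, hR, hK⟩ := K.isBounded.exists_pos_norm_le
  refine ⟨(4 * ⌈R⌉₊) ^ n * C, fun l => ?_⟩
  have hR1 : 1 ≤ ⌈R⌉₊ := Nat.one_le_iff_ne_zero.2 (Nat.ceil_pos.2 hR).ne'
  have := hμ.abs_le_of_coord_width_le hC0 h (M := 2 * ⌈R⌉₊ * (l + 1)) (by nlinarith) Finset.univ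
    (((l : ℝ) + 1) • K) (fun i _ => ⟨-(R * (l + 1)), ?_⟩) (by simp)
  · refine this.trans_eq ?_
    rw [Finset.card_univ, Fintype.card_fin]
    push_cast
    rw [show (2 : ℝ) * (2 * ⌈R⌉₊ * (l + 1)) = 4 * ⌈R⌉₊ * (l + 1) by ring, mul_pow]
    ring
  · rintro _ ⟨x, hx, rfl⟩
    have h1 : |x i| ≤ R := (PiLp.norm_apply_le x i).trans (hK x hx)
    have h2 := Nat.le_ceil R
    rw [abs_le] at h1
    simp only [PiLp.smul_apply, smul_eq_mul, Set.mem_Icc]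
    push_cast
    have hl : (0 : ℝ) ≤ l := l.cast_nonneg
    constructor <;> nlinarith

end Bound

section Density

variable {V : Type*} [NormedAddCommGroup V] [NormedSpace ℝ V]

theorem ConvexBody.dense_polytopes :
    Dense {K : ConvexBody V | ∃ s : Set V, s.Finite ∧ (K : Set V) = convexHull ℝ s} := by
  intro K
  rw [Metric.mem_closure_iff]
  intro ε hε
  obtain ⟨s, hsK, hs, hcov⟩ := K.isCompact.finite_cover_balls (half_pos hε)
  have hmem : ∀ x ∈ (K : Set V), ∃ y ∈ s, dist x y < ε / 2 := fun x hx => by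
    simpa using hcov hx
  have hne : s.Nonempty := by
    obtain ⟨x, hx⟩ := K.nonempty
    obtain ⟨y, hy, -⟩ := hmem x hx
    exact ⟨y, hy⟩
  let P : ConvexBody V := ⟨convexHull ℝ s, convex_convexHull ℝ s,
    hs.isCompact_convexHull (𝕜 := ℝ), hne.convexHull⟩
  refine ⟨P, ⟨s, hs, rfl⟩, lt_of_le_of_lt ?_ (half_lt_self hε)⟩
  rw [← ConvexBody.hausdorffDist_coe]
  refine Metric.hausdorffDist_le_of_mem_dist (by positivity) (fun x hx => ?_) fun x hx => ?_
  · obtain ⟨y, hy, hxy⟩ := hmem x hx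
    exact ⟨y, subset_convexHull ℝ s hy, hxy.le⟩
  · exact ⟨x, convexHull_min hsK K.convex hx, by simpa using (half_pos hε).le⟩

end Density

section Components

open Polynomial

theorem Polynomial.natDegree_le_of_forall_abs_eval_le {q : ℝ[X]} {n : ℕ} {C : ℝ}
    (h : ∀ l : ℕ, |q.eval ((l : ℝ) + 1)| ≤ C * ((l : ℝ) + 1) ^ n) : q.natDegree ≤ n := by
  by_contra! hn
  have hlo : (fun x : ℝ => (X ^ n : ℝ[X]).eval x) =o[Filter.atTop] fun x => q.eval x :=
    Polynomial.isLittleO_atTop_of_degree_lt _ _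
      (by
        have h0 : q ≠ 0 := fun h0 => by simp [h0] at hn
        rw [degree_X_pow, degree_eq_natDegree h0]
        exact_mod_cast hn)
  have ht : Filter.Tendsto (fun l : ℕ => (l : ℝ) + 1) Filter.atTop Filter.atTop :=
    Filter.tendsto_atTop_add_const_right _ _ tendsto_natCast_atTop_atTop
  have hO : (fun l : ℕ => q.eval ((l : ℝ) + 1)) =O[Filter.atTop]
      fun l : ℕ => (X ^ n : ℝ[X]).eval ((l : ℝ) + 1) :=
    Asymptotics.IsBigO.of_bound C (Filter.Eventually.of_forall fun l => by
      have hl : (0 : ℝ) ≤ (l : ℝ) + 1 := by positivity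
      simpa [abs_of_nonneg hl] using h l)
  refine Asymptotics.isLittleO_irrefl (Filter.Frequently.of_forall fun l => ?_)
    ((hlo.comp_tendsto ht).trans_isBigO hO)
  simp only [Function.comp_apply, eval_pow, eval_X]
  positivity

theorem Polynomial.eq_of_forall_eval_natCast_add_one {p q : ℝ[X]}
    (h : ∀ l : ℕ, p.eval ((l : ℝ) + 1) = q.eval ((l : ℝ) + 1)) : p = q := by
  refine eq_of_infinite_eval_eq p q ((Set.infinite_range_of_injective
    (f := fun l : ℕ => (l : ℝ) + 1) fun a b hab => ?_).mono (Set.range_subset_iff.2 h))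
  simpa using hab

/-- The Lagrange basis polynomials for the nodes `1, …, n + 1`. -/
def nodeBasis (n j : ℕ) : ℝ[X] :=
  Lagrange.basis (Finset.range (n + 1)) (fun j : ℕ => (j : ℝ) + 1) j

variable {V : Type*} [NormedAddCommGroup V] [NormedSpace ℝ V]

/-- The polynomial of degree at most `n` interpolating `t ↦ μ (t • K)` at `1, …, n + 1`. -/
def dilatePoly (n : ℕ) (μ : ConvexBody V → ℝ) (K : ConvexBody V) : ℝ[X] :=
  ∑ j ∈ Finset.range (n + 1), C (μ (((j : ℝ) + 1) • K)) * nodeBasis n j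

/-- The candidate for the component of degree `k` of a valuation. -/
def component (n : ℕ) (μ : ConvexBody V → ℝ) (k : ℕ) (K : ConvexBody V) : ℝ :=
  ∑ j ∈ Finset.range (n + 1), (nodeBasis n j).coeff k * μ (((j : ℝ) + 1) • K)

theorem injOn_natCast_add_one (s : Set ℕ) : Set.InjOn (fun j : ℕ => (j : ℝ) + 1) s :=
  fun a _ b _ hab => by simpa using hab

theorem dilatePoly_eq_interpolate (n : ℕ) (μ : ConvexBody V → ℝ) (K : ConvexBody V) :
    dilatePoly n μ K = Lagrange.interpolate (Finset.range (n + 1)) (fun j : ℕ => (j : ℝ) + 1)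
      fun j => μ (((j : ℝ) + 1) • K) := rfl

theorem natDegree_dilatePoly_lt (n : ℕ) (μ : ConvexBody V → ℝ) (K : ConvexBody V) :
    (dilatePoly n μ K).natDegree < n + 1 := by
  have h := Lagrange.degree_interpolate_lt (s := Finset.range (n + 1))
    (v := fun j : ℕ => (j : ℝ) + 1) (fun j => μ (((j : ℝ) + 1) • K)) (injOn_natCast_add_one _)
  rw [← dilatePoly_eq_interpolate, Finset.card_range] at h
  by_cases h0 : dilatePoly n μ K = 0
  · simp [h0]
  · exact (natDegree_lt_iff_degree_lt h0).2 h

theorem coeff_dilatePoly (n : ℕ) (μ : ConvexBody V → ℝ) (K : ConvexBody V) (k : ℕ) :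
    (dilatePoly n μ K).coeff k = component n μ k K := by
  simp only [dilatePoly, component, finsetSum_coeff, coeff_C_mul]
  exact Finset.sum_congr rfl fun _ _ => mul_comm _ _

theorem IsValuation.component {μ : ConvexBody V → ℝ} (hμ : IsValuation μ) (n k : ℕ) :
    IsValuation (component n μ k) :=
  IsValuation.sum fun _ _ => (hμ.comp_smul (by positivity)).const_mul _

theorem Continuous.component {μ : ConvexBody V → ℝ} (hμ : Continuous μ) (n k : ℕ) :
    Continuous (component n μ k) :=
  continuous_finsetSum _ fun _ _ =>
    (hμ.comp (ConvexBody.continuous_const_smul _)).const_mul _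

theorem TransInv.component {μ : ConvexBody V → ℝ} (hμ : TransInv μ) (n k : ℕ) :
    TransInv (component n μ k) := fun K x =>
  Finset.sum_congr rfl fun _ _ => congrArg _ (hμ.comp_smul _ K x)

variable {n : ℕ} {μ : ConvexBody (Eucl n) → ℝ}

theorem eval_dilatePoly (hval : IsValuation μ) (hcont : Continuous μ) (htrans : TransInv μ)
    (K : ConvexBody (Eucl n)) (l : ℕ) :
    (dilatePoly n μ K).eval ((l : ℝ) + 1) = μ (((l : ℝ) + 1) • K) := by
  have hclosed : IsClosed {K : ConvexBody (Eucl n) |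
      (dilatePoly n μ K).eval ((l : ℝ) + 1) = μ (((l : ℝ) + 1) • K)} := by
    refine isClosed_eq ?_ (hcont.comp (ConvexBody.continuous_const_smul _))
    simp only [dilatePoly, eval_finsetSum, eval_mul, eval_C]
    exact continuous_finsetSum _ fun j _ =>
      (hcont.comp (ConvexBody.continuous_const_smul _)).mul_const _
  refine hclosed.closure_subset_iff.2 ?_ (ConvexBody.dense_polytopes K)
  rintro P ⟨s, hs, hP⟩
  obtain ⟨N, hN⟩ := IsValuation.exists_fwdDiff_iter_eq_zero hs hval htrans P hP
  obtain ⟨p, hp⟩ := exists_polynomial_of_fwdDiff_iter_eq_zero hN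
  obtain ⟨C, hC⟩ := hval.exists_abs_smul_le hcont htrans P
  have hq : ∀ l : ℕ, (p.comp (X - 1)).eval ((l : ℝ) + 1) = μ (((l : ℝ) + 1) • P) := by
    intro l
    simp [eval_comp, hp l]
  have hdeg : (p.comp (X - 1)).natDegree ≤ n :=
    natDegree_le_of_forall_abs_eval_le fun l => by rw [hq l]; exact hC l
  have : p.comp (X - 1) = dilatePoly n μ P := by
    rw [dilatePoly_eq_interpolate]
    refine Lagrange.eq_interpolate_of_eval_eq (v := fun j : ℕ => (j : ℝ) + 1) _
      (injOn_natCast_add_one _) ?_ fun i _ => hq i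
    rw [Finset.card_range]
    exact degree_le_natDegree.trans_lt (by exact_mod_cast Nat.lt_succ_of_le hdeg)
  change (dilatePoly n μ P).eval ((l : ℝ) + 1) = μ (((l : ℝ) + 1) • P)
  rw [← this, hq]

theorem sum_component (hval : IsValuation μ) (hcont : Continuous μ) (htrans : TransInv μ)
    (K : ConvexBody (Eucl n)) : μ K = ∑ k : Fin (n + 1), component n μ k K := by
  have h := eval_dilatePoly hval hcont htrans K 0
  rw [eval_eq_sum_range' (natDegree_dilatePoly_lt n μ K)] at h
  simpa [coeff_dilatePoly, Fin.sum_univ_eq_sum_range (fun k => component n μ k K)] using h.symm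

theorem component_natCast_smul (hval : IsValuation μ) (hcont : Continuous μ)
    (htrans : TransInv μ) (k : ℕ) (K : ConvexBody (Eucl n)) {m : ℕ} (hm : m ≠ 0) :
    component n μ k ((m : ℝ) • K) = (m : ℝ) ^ k * component n μ k K := by
  obtain ⟨m, rfl⟩ := Nat.exists_eq_succ_of_ne_zero hm
  have h : dilatePoly n μ (((m + 1 : ℕ) : ℝ) • K) =
      (dilatePoly n μ K).comp (C ((m + 1 : ℕ) : ℝ) * X) := by
    refine eq_of_forall_eval_natCast_add_one fun l => ?_
    have h' := eval_dilatePoly hval hcont htrans K (l * m + l + m)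
    rw [eval_dilatePoly hval hcont htrans, eval_comp, smul_smul]
    simp only [eval_mul, eval_C, eval_X]
    have e : ((l * m + l + m : ℕ) : ℝ) + 1 = ((l : ℝ) + 1) * ((m + 1 : ℕ) : ℝ) := by
      push_cast; ring
    rw [← e, mul_comm ((m + 1 : ℕ) : ℝ), ← e, h']
  rw [← coeff_dilatePoly, Nat.succ_eq_add_one, h, comp_C_mul_X_coeff, coeff_dilatePoly, mul_comm]

theorem homog_component (hval : IsValuation μ) (hcont : Continuous μ) (htrans : TransInv μ)
    (k : ℕ) : Homog k (component n μ k) := by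
  intro K t ht
  rw [ConvexBody.dilate_eq_smul]
  have hseq : Filter.Tendsto (fun m : ℕ => ((⌈t * m⌉₊ : ℕ) : ℝ) / m) Filter.atTop (nhds t) :=
    (tendsto_nat_ceil_mul_div_atTop ht.le).comp tendsto_natCast_atTop_atTop
  have hc : Continuous fun t : ℝ => component n μ k (t • K) :=
    (hcont.component n k).comp (ConvexBody.continuous_smul_const K)
  have hp : Continuous fun t : ℝ => t ^ k * component n μ k K := by fun_prop
  refine tendsto_nhds_unique_of_eventuallyEq ((hc.tendsto t).comp hseq)
    ((hp.tendsto t).comp hseq) ?_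
  filter_upwards [Filter.eventually_gt_atTop 0] with m hm
  have hm' : (m : ℝ) ≠ 0 := by positivity
  have h1 := component_natCast_smul hval hcont htrans k ((m : ℝ)⁻¹ • K) hm.ne'
  rw [smul_smul, mul_inv_cancel₀ hm', one_smul] at h1
  have h2 := component_natCast_smul hval hcont htrans k ((m : ℝ)⁻¹ • K)
    (Nat.ceil_pos.2 (show 0 < t * m by positivity)).ne'
  rw [smul_smul, ← div_eq_mul_inv] at h2
  simp only [Function.comp_apply]
  rw [h2, h1, div_pow]
  field_simp

theorem component_eq_of_sum_homog (hval : IsValuation μ) (hcont : Continuous μ)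
    (htrans : TransInv μ) {ν : Fin (n + 1) → ConvexBody (Eucl n) → ℝ}
    (hν : ∀ k : Fin (n + 1), Homog (k : ℕ) (ν k)) (hsum : ∀ K, μ K = ∑ k, ν k K) (k : Fin (n + 1))
    (K : ConvexBody (Eucl n)) : ν k K = component n μ k K := by
  have h : dilatePoly n μ K = ∑ k : Fin (n + 1), C (ν k K) * X ^ (k : ℕ) := by
    refine eq_of_forall_eval_natCast_add_one fun l => ?_
    rw [eval_dilatePoly hval hcont htrans, hsum, eval_finsetSum]
    refine Finset.sum_congr rfl fun k _ => ?_
    rw [← ConvexBody.dilate_eq_smul, hν k K _ (by positivity)]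
    simp only [eval_mul, eval_C, eval_pow, eval_X]
    exact mul_comm _ _
  rw [← coeff_dilatePoly, h, finsetSum_coeff]
  simp [coeff_X_pow, Fin.val_inj]

end Components

section Parity

variable {V : Type*} [NormedAddCommGroup V] [NormedSpace ℝ V] {μ : ConvexBody V → ℝ}

theorem IsValuation.comp_reflect (hμ : IsValuation μ) :
    IsValuation fun K : ConvexBody V => μ K.reflect := by
  simpa only [ConvexBody.reflect_eq_smul] using hμ.comp_smul (t := -1) (by norm_num)

theorem TransInv.comp_reflect (hμ : TransInv μ) : TransInv fun K : ConvexBody V => μ K.reflect := by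
  simpa only [ConvexBody.reflect_eq_smul] using hμ.comp_smul (-1)

theorem Continuous.comp_reflect (hμ : Continuous μ) : Continuous fun K : ConvexBody V => μ K.reflect := by
  simp only [ConvexBody.reflect_eq_smul]
  exact hμ.comp (ConvexBody.continuous_const_smul (-1))

theorem Homog.comp_reflect {k : ℕ} (hμ : Homog k μ) : Homog k fun K : ConvexBody V => μ K.reflect := by
  intro K t ht
  simp only [ConvexBody.reflect_eq_smul, ConvexBody.dilate_eq_smul, smul_comm (-1 : ℝ) t K]
  exact hμ _ t ht

/-- The combination `(μ K + c * μ (-K)) / 2`, for `c = ±1` the even resp. odd part of `μ`. -/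
def parityPart (c : ℝ) (μ : ConvexBody V → ℝ) (K : ConvexBody V) : ℝ :=
  1 / 2 * (μ K + c * μ K.reflect)

theorem IsValuation.parityPart (hμ : IsValuation μ) (c : ℝ) : IsValuation (parityPart c μ) :=
  (hμ.add (hμ.comp_reflect.const_mul c)).const_mul _

theorem Continuous.parityPart (hμ : Continuous μ) (c : ℝ) : Continuous (parityPart c μ) :=
  (hμ.add (hμ.comp_reflect.const_mul c)).const_mul _

theorem TransInv.parityPart (hμ : TransInv μ) (c : ℝ) : TransInv (parityPart c μ) := fun K x => by
  have h := hμ.comp_reflect K x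
  simp only at h
  simp only [_root_.parityPart, hμ K x, h]

theorem Homog.parityPart {k : ℕ} (hμ : Homog k μ) (c : ℝ) : Homog k (parityPart c μ) :=
  fun K t ht => by
    have h := hμ.comp_reflect K t ht
    simp only at h
    simp only [_root_.parityPart, hμ K t ht, h]
    ring

theorem evenVal_parityPart (μ : ConvexBody V → ℝ) : EvenVal (parityPart 1 μ) := fun K => by
  simp only [parityPart, ConvexBody.reflect_reflect]
  ring

theorem oddVal_parityPart (μ : ConvexBody V → ℝ) : OddVal (parityPart (-1) μ) := fun K => by
  simp only [parityPart, ConvexBody.reflect_reflect]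
  ring

end Parity

/-- **McMullen's decomposition.** Every continuous translation invariant valuation on `ℝⁿ`
decomposes uniquely as a sum of continuous translation invariant valuations `μ_k^±`
(`k = 0, …, n`) which are homogeneous of degree `k` and even resp. odd. -/
theorem mcmullen_decomposition (n : ℕ) (hn : 1 ≤ n)
    (μ : ConvexBody (Eucl n) → ℝ)
    (hval : IsValuation μ) (hcont : Continuous μ) (htrans : TransInv μ) :
    ∃! p : (Fin (n + 1) → ConvexBody (Eucl n) → ℝ) × (Fin (n + 1) → ConvexBody (Eucl n) → ℝ),
      (∀ k : Fin (n + 1), IsValuation (p.1 k) ∧ Continuous (p.1 k) ∧ TransInv (p.1 k) ∧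
        Homog (k : ℕ) (p.1 k) ∧ EvenVal (p.1 k)) ∧
      (∀ k : Fin (n + 1), IsValuation (p.2 k) ∧ Continuous (p.2 k) ∧ TransInv (p.2 k) ∧
        Homog (k : ℕ) (p.2 k) ∧ OddVal (p.2 k)) ∧
      (∀ K : ConvexBody (Eucl n), μ K = ∑ k : Fin (n + 1), (p.1 k K + p.2 k K)) := by
  refine ⟨(fun k => parityPart 1 (component n μ k), fun k => parityPart (-1) (component n μ k)),
    ⟨fun k => ?_, fun k => ?_, fun K => ?_⟩, ?_⟩
  · exact ⟨(hval.component n k).parityPart 1, (hcont.component n k).parityPart 1,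
      (htrans.component n k).parityPart 1, (homog_component hval hcont htrans k).parityPart 1,
      evenVal_parityPart _⟩
  · exact ⟨(hval.component n k).parityPart (-1), (hcont.component n k).parityPart (-1),
      (htrans.component n k).parityPart (-1),
      (homog_component hval hcont htrans k).parityPart (-1), oddVal_parityPart _⟩
  · rw [sum_component hval hcont htrans K]
    refine Finset.sum_congr rfl fun k _ => ?_
    simp only [parityPart]
    ring
  · rintro ⟨p, q⟩ ⟨hp, hq, hsum⟩
    have h : ∀ k K, p k K + q k K = component n μ k K := fun k K =>
      component_eq_of_sum_homog hval hcont htrans (ν := fun k K => p k K + q k K)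
        (fun k K t ht => by
          have hp' : p k (ConvexBody.dilate t K) = t ^ (k : ℕ) * p k K := (hp k).2.2.2.1 K t ht
          have hq' : q k (ConvexBody.dilate t K) = t ^ (k : ℕ) * q k K := (hq k).2.2.2.1 K t ht
          simp only [hp', hq']
          ring) hsum k K
    have h' : ∀ k K, p k K - q k K = component n μ k K.reflect := fun k K => by
      have hp' : p k K.reflect = p k K := (hp k).2.2.2.2 K
      have hq' : q k K.reflect = -q k K := (hq k).2.2.2.2 K
      rw [← h, hp', hq', sub_eq_add_neg]
    refine Prod.ext (funext₂ fun k K => ?_) (funext₂ fun k K => ?_)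
    · simp only [parityPart]
      linarith [h k K, h' k K]
    · simp only [parityPart]
      linarith [h k K, h' k K]
end
end

section
/- Let n ≥ 1 and let μ be a continuous translation-invariant valuation on ℝⁿ that is homogeneous of degree n. Then there exists a constant c ∈ ℝ such that μ(K) = c · vol_n(K) for every nonempty compact convex K ⊆ ℝⁿ, where vol_n is Lebesgue measure. (The space Val_n is one-dimensional and spanned by the volume.) -/
open MeasureTheory Pointwise
open scoped NNReal ENNReal

noncomputable section

open Set Function Filter Topology

/-- The closed axis-parallel box with lowest corner `a` and side lengths `w`. -/
def coordBox {n : ℕ} (a w : Fin n → ℝ) : Set (Eucl n) := {x | ∀ i, a i ≤ x i ∧ x i ≤ a i + w i}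

/-- The half-open axis-parallel box with lowest corner `a` and side lengths `w`. -/
def coordBoxIco {n : ℕ} (a w : Fin n → ℝ) : Set (Eucl n) := {x | ∀ i, a i ≤ x i ∧ x i < a i + w i}

section Boxes

variable {n : ℕ}

theorem isClosed_coordBox (a w : Fin n → ℝ) : IsClosed (coordBox a w) := by
  have : coordBox a w = ⋂ i, {x : Eucl n | a i ≤ x i} ∩ {x | x i ≤ a i + w i} := by
    ext x; simp [coordBox]
  rw [this]
  exact isClosed_iInter fun i =>
    (isClosed_le continuous_const (by fun_prop)).inter (isClosed_le (by fun_prop) continuous_const)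

theorem convex_coord_le (i : Fin n) (c : ℝ) : Convex ℝ {x : Eucl n | x i ≤ c} :=
  convex_halfSpace_le (f := fun x : Eucl n => x i) ⟨fun _ _ => rfl, fun _ _ => rfl⟩ c

theorem convex_coord_ge (i : Fin n) (c : ℝ) : Convex ℝ {x : Eucl n | c ≤ x i} :=
  convex_halfSpace_ge (f := fun x : Eucl n => x i) ⟨fun _ _ => rfl, fun _ _ => rfl⟩ c

theorem convex_coord_eq (i : Fin n) (c : ℝ) : Convex ℝ {x : Eucl n | x i = c} :=
  convex_hyperplane (f := fun x : Eucl n => x i) ⟨fun _ _ => rfl, fun _ _ => rfl⟩ c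

theorem isClosed_coord_le (i : Fin n) (c : ℝ) : IsClosed {x : Eucl n | x i ≤ c} :=
  isClosed_le (by fun_prop) continuous_const

theorem isClosed_coord_ge (i : Fin n) (c : ℝ) : IsClosed {x : Eucl n | c ≤ x i} :=
  isClosed_le continuous_const (by fun_prop)

theorem isClosed_coord_eq (i : Fin n) (c : ℝ) : IsClosed {x : Eucl n | x i = c} :=
  isClosed_eq (by fun_prop) continuous_const

theorem convex_coordBox (a w : Fin n → ℝ) : Convex ℝ (coordBox a w) := by
  have : coordBox a w = ⋂ i, {x : Eucl n | a i ≤ x i} ∩ {x | x i ≤ a i + w i} := by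
    ext x; simp [coordBox]
  rw [this]
  exact convex_iInter fun i => (convex_coord_ge i _).inter (convex_coord_le i _)

theorem dist_le_of_mem_coordBox {a : Fin n → ℝ} {l : ℝ} (hl : 0 ≤ l) {x y : Eucl n}
    (hx : x ∈ coordBox a fun _ => l) (hy : y ∈ coordBox a fun _ => l) :
    dist x y ≤ √n * l := by
  rw [EuclideanSpace.dist_eq]
  refine Real.sqrt_le_iff.2 ⟨by positivity, ?_⟩
  rw [mul_pow, Real.sq_sqrt (by positivity)]
  calc ∑ i, dist (x i) (y i) ^ 2 ≤ ∑ _i : Fin n, l ^ 2 := by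
        refine Finset.sum_le_sum fun i _ => ?_
        have h1 := hx i
        have h2 := hy i
        have : dist (x i) (y i) ≤ l := by
          rw [Real.dist_eq, abs_le]
          constructor <;> linarith
        gcongr
    _ = n * l ^ 2 := by simp

theorem isCompact_coordBox (a : Fin n → ℝ) {l : ℝ} (hl : 0 ≤ l) :
    IsCompact (coordBox a fun _ => l) :=
  Metric.isCompact_of_isClosed_isBounded (isClosed_coordBox _ _)
    (Metric.isBounded_iff.2 ⟨_, fun _ hx _ hy => dist_le_of_mem_coordBox hl hx hy⟩)

theorem measurableSet_coordBoxIco (a w : Fin n → ℝ) : MeasurableSet (coordBoxIco a w) := by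
  have : coordBoxIco a w = ⋂ i, {x : Eucl n | a i ≤ x i} ∩ {x | x i < a i + w i} := by
    ext x; simp [coordBoxIco]
  rw [this]
  exact MeasurableSet.iInter fun i => (isClosed_coord_ge i _).measurableSet.inter
    (isOpen_lt (by fun_prop) continuous_const).measurableSet

theorem volume_real_coordBox (a : Fin n → ℝ) {l : ℝ} (hl : 0 ≤ l) :
    volume.real (coordBox a fun _ => l) = l ^ n := by
  have : coordBox a (fun _ => l) = WithLp.ofLp ⁻¹' (Icc a (a + fun _ => l)) := by
    ext x; simp [coordBox, Pi.le_def, forall_and]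
  rw [this, Measure.real, (PiLp.volume_preserving_ofLp (Fin n)).measure_preimage
    measurableSet_Icc.nullMeasurableSet, Real.volume_Icc_pi_toReal]
  · simp
  · intro i; simp [hl]

theorem volume_real_coordBoxIco (a : Fin n → ℝ) {l : ℝ} (hl : 0 ≤ l) :
    volume.real (coordBoxIco a fun _ => l) = l ^ n := by
  have : coordBoxIco a (fun _ => l) = WithLp.ofLp ⁻¹' (pi univ fun i => Ico (a i) (a i + l)) := by
    ext x; simp [coordBoxIco]
  rw [this, Measure.real, (PiLp.volume_preserving_ofLp (Fin n)).measure_preimage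
    (MeasurableSet.univ_pi fun i => measurableSet_Ico).nullMeasurableSet]
  have h := Real.volume_pi_Ico_toReal (a := a) (b := fun i => a i + l) (fun i => by simp [hl])
  simpa using h

/-- A property of boxes that passes from the two halves of a box to the whole box holds for all
cubes of side `l` as soon as it holds for all cubes of side `l / 2 ^ k`. -/
theorem cube_of_small_cubes {P : (Fin n → ℝ) → (Fin n → ℝ) → Prop}
    (hP : ∀ a w j, (∀ i, 0 < w i) → P a (update w j (w j / 2)) →
      P (update a j (a j + w j / 2)) (update w j (w j / 2)) → P a w)
    {l : ℝ} (hl : 0 < l) (k : ℕ) (hk : ∀ a, P a fun _ => l / 2 ^ k) (a : Fin n → ℝ) :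
    P a fun _ => l := by
  have step : ∀ l : ℝ, 0 < l → (∀ a, P a fun _ => l / 2) → ∀ a, P a fun _ => l := by
    intro l hl h
    have key : ∀ (s : Finset (Fin n)) a, P a fun i => if i ∈ s then l else l / 2 := by
      intro s
      induction s using Finset.induction_on with
      | empty => simpa using h
      | insert j s hj ih =>
        intro a
        have hu : update (fun i => if i ∈ insert j s then l else l / 2) j
            ((if j ∈ insert j s then l else l / 2) / 2) = fun i => if i ∈ s then l else l / 2 := by
          funext i
          by_cases hij : i = j
          · subst hij; simp [hj]
          · simp [hij]
        refine hP a _ j (fun i => by split_ifs <;> positivity) ?_ ?_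
        · rw [hu]; exact ih _
        · rw [hu]; exact ih _
    intro a
    simpa using key Finset.univ a
  induction k generalizing a with
  | zero => simpa using hk a
  | succ k ih =>
    refine ih (step _ (by positivity) ?_) a
    intro a
    have := hk a
    rwa [pow_succ, ← div_div] at this

theorem inter_coordBox_le_half (a w : Fin n → ℝ) (j : Fin n) (hw : 0 ≤ w j) :
    coordBox a w ∩ {x | x j ≤ a j + w j / 2} = coordBox a (update w j (w j / 2)) := by
  ext x
  simp only [coordBox, mem_inter_iff, mem_ofPred_eq]
  constructor
  · rintro ⟨h, hj⟩ i
    by_cases hij : i = j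
    · subst hij; simpa using ⟨(h i).1, hj⟩
    · simpa [hij] using h i
  · intro h
    refine ⟨fun i => ?_, by simpa using (h j).2⟩
    by_cases hij : i = j
    · subst hij
      have := h i
      simp only [update_self] at this
      constructor <;> linarith
    · simpa [hij] using h i

theorem inter_coordBox_ge_half (a w : Fin n → ℝ) (j : Fin n) (hw : 0 ≤ w j) :
    coordBox a w ∩ {x | a j + w j / 2 ≤ x j} =
      coordBox (update a j (a j + w j / 2)) (update w j (w j / 2)) := by
  ext x
  simp only [coordBox, mem_inter_iff, mem_ofPred_eq]
  constructor
  · rintro ⟨h, hj⟩ i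
    by_cases hij : i = j
    · subst hij
      have := h i
      simp only [update_self]
      constructor <;> linarith
    · simpa [hij] using h i
  · intro h
    refine ⟨fun i => ?_, by simpa using (h j).1⟩
    by_cases hij : i = j
    · subst hij
      have := h i
      simp only [update_self] at this
      constructor <;> linarith
    · simpa [hij] using h i

theorem volume_real_inter_coordBoxIco_halves (N : Set (Eucl n)) (hN : volume N ≠ ⊤)
    (a w : Fin n → ℝ) (j : Fin n) (hw : 0 ≤ w j) :
    volume.real (N ∩ coordBoxIco a (update w j (w j / 2))) +
      volume.real (N ∩ coordBoxIco (update a j (a j + w j / 2)) (update w j (w j / 2))) ≤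
    volume.real (N ∩ coordBoxIco a w) := by
  have hfin : volume (N ∩ coordBoxIco a w) ≠ ⊤ := measure_ne_top_of_subset inter_subset_left hN
  rw [← measureReal_inter_add_sdiff (s := N ∩ coordBoxIco a w)
    (t := {x : Eucl n | a j + w j / 2 ≤ x j}) (isClosed_coord_ge j _).measurableSet hfin, add_comm]
  refine add_le_add (measureReal_mono ?_ (measure_ne_top_of_subset inter_subset_left hfin))
    (measureReal_mono ?_ (measure_ne_top_of_subset sdiff_subset hfin))
  · rintro x ⟨hxN, hx⟩
    have hj := hx j
    simp only [update_self] at hj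
    refine ⟨⟨hxN, fun i => ?_⟩, hj.1⟩
    by_cases hij : i = j
    · subst hij; constructor <;> linarith
    · simpa [hij] using hx i
  · rintro x ⟨hxN, hx⟩
    have hj := hx j
    simp only [update_self] at hj
    refine ⟨⟨hxN, fun i => ?_⟩, not_le.2 hj.2⟩
    by_cases hij : i = j
    · subst hij; constructor <;> linarith
    · simpa [hij] using hx i

theorem exists_subset_coordBox {A : Set (Eucl n)} (hA : IsCompact A) :
    ∃ (a : Fin n → ℝ) (l : ℝ), 0 < l ∧ A ⊆ coordBox a fun _ => l := by
  obtain ⟨R, hR⟩ := hA.isBounded.exists_norm_le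
  refine ⟨fun _ => -(|R| + 1), 2 * (|R| + 1), by positivity, fun x hx i => ?_⟩
  have h := abs_le.1 ((Real.norm_eq_abs (x i) ▸ PiLp.norm_apply_le x i).trans (hR x hx))
  have := le_abs_self R
  constructor <;> linarith

end Boxes

/-- A real function on sets that behaves, on compact convex sets, like a valuation under cutting
along coordinate hyperplanes, with at most the growth of the volume. -/
structure IsCutValuation {n : ℕ} (ρ : Set (Eucl n) → ℝ) : Prop where
  empty : ρ ∅ = 0
  cut : ∀ A : Set (Eucl n), Convex ℝ A → IsCompact A → ∀ i c,
    ρ A + ρ (A ∩ {x | x i = c}) = ρ (A ∩ {x | x i ≤ c}) + ρ (A ∩ {x | c ≤ x i})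
  bound : ∃ B : ℝ, 0 ≤ B ∧ ∀ (A : Set (Eucl n)) (a : Fin n → ℝ) (l : ℝ), Convex ℝ A →
    IsCompact A → 0 < l → A ⊆ coordBox a (fun _ => l) → |ρ A| ≤ B * l ^ n

namespace IsCutValuation

variable {n : ℕ} {ρ : Set (Eucl n) → ℝ}

theorem eq_zero_of_subset_flat (h : IsCutValuation ρ) (s : Finset (Fin n)) :
    s ≠ Finset.univ → ∀ (b : Fin n → ℝ) (A : Set (Eucl n)), Convex ℝ A → IsCompact A →
      (∀ x ∈ A, ∀ i ∉ s, x i = b i) → ρ A = 0 := by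
  induction s using Finset.strongInduction with
  | H s ih =>
  intro hs b A hA hAc hAb
  obtain ⟨B, hB, hbound⟩ := h.bound
  have hcard : s.card < n := by
    simpa using Finset.card_lt_univ_of_notMem
      (not_forall.1 (mt Finset.eq_univ_iff_forall.2 hs)).choose_spec
  obtain ⟨a, l, hl, hAl⟩ := exists_subset_coordBox hAc
  have main : ∀ k : ℕ, |ρ A| ≤ B * (l / 2 ^ k) ^ (n - s.card) * l ^ s.card := by
    intro k
    set C := B * (l / 2 ^ k) ^ (n - s.card) with hC
    have := cube_of_small_cubes (P := fun a w => ∀ A : Set (Eucl n), Convex ℝ A → IsCompact A →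
      (∀ x ∈ A, ∀ i ∉ s, x i = b i) → (∀ x ∈ A, ∀ i ∈ s, a i ≤ x i ∧ x i ≤ a i + w i) →
        |ρ A| ≤ C * ∏ i ∈ s, w i) ?_ hl k ?_ a A hA hAc hAb (fun x hx i _ => hAl hx i)
    · simpa using this
    · intro a w j hw h1 h2 A hA hAc hAb hAw
      by_cases hj : j ∈ s
      · have hface : ρ (A ∩ {x | x j = a j + w j / 2}) = 0 := by
          refine ih _ (Finset.erase_ssubset hj)
            (fun he => Finset.notMem_erase j s (he ▸ Finset.mem_univ j))
            (update b j (a j + w j / 2)) _ (hA.inter (convex_coord_eq _ _))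
            (hAc.inter_right (isClosed_coord_eq _ _)) fun x hx i hi => ?_
          by_cases hij : i = j
          · subst hij; simpa using hx.2
          · simpa [hij] using hAb x hx.1 i (fun his => hi (Finset.mem_erase.2 ⟨hij, his⟩))
        have hcut := h.cut A hA hAc j (a j + w j / 2)
        have hprod : ∏ i ∈ s, update w j (w j / 2) i = (∏ i ∈ s, w i) / 2 := by
          rw [Finset.prod_update_of_mem hj, ← Finset.mul_prod_erase s w hj,
            Finset.sdiff_singleton_eq_erase]
          ring
        rw [hprod] at h1 h2
        have e1 := h1 _ (hA.inter (convex_coord_le j (a j + w j / 2)))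
          (hAc.inter_right (isClosed_coord_le _ _)) (fun x hx => hAb x hx.1) (fun x hx i hi => by
            have hxi := hAw x hx.1 i hi
            by_cases hij : i = j
            · subst hij; simpa using ⟨hxi.1, hx.2⟩
            · simpa [hij] using hxi)
        have e2 := h2 _ (hA.inter (convex_coord_ge j (a j + w j / 2)))
          (hAc.inter_right (isClosed_coord_ge _ _)) (fun x hx => hAb x hx.1) (fun x hx i hi => by
            have hxi := hAw x hx.1 i hi
            by_cases hij : i = j
            · subst hij
              have hge : a i + w i / 2 ≤ x i := hx.2
              simp only [update_self]
              constructor <;> linarith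
            · simpa [hij] using hxi)
        rw [hface, add_zero] at hcut
        rw [hcut]
        refine (abs_add_le _ _).trans ?_
        linarith
      · have := h1 A hA hAc hAb (fun x hx i hi => by
          simpa [ne_of_mem_of_not_mem hi hj] using hAw x hx i hi)
        rwa [Finset.prod_update_of_notMem hj] at this
    · intro a A hA hAc hAb hAw
      have hlk : 0 < l / 2 ^ k := by positivity
      refine (hbound A (fun i => if i ∈ s then a i else b i) (l / 2 ^ k) hA hAc hlk
        fun x hx i => ?_).trans (le_of_eq ?_)
      · by_cases hi : i ∈ s
        · simpa [hi] using hAw x hx i hi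
        · simpa [hi, hAb x hx i hi] using hlk.le
      · rw [hC, Finset.prod_const, mul_assoc, ← pow_add, Nat.sub_add_cancel hcard.le]
  have hlim : Tendsto (fun k : ℕ => B * (l / 2 ^ k) ^ (n - s.card) * l ^ s.card) atTop (𝓝 0) := by
    have h0 : Tendsto (fun k : ℕ => l / (2 : ℝ) ^ k) atTop (𝓝 0) :=
      tendsto_const_nhds.div_atTop (tendsto_pow_atTop_atTop_of_one_lt one_lt_two)
    have h1 := ((h0.pow (n - s.card)).const_mul B).mul_const (l ^ s.card)
    rwa [zero_pow (Nat.sub_ne_zero_of_lt hcard), mul_zero, zero_mul] at h1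
  exact abs_nonpos_iff.1 (ge_of_tendsto' hlim main)

theorem add_of_cut (h : IsCutValuation ρ) {A : Set (Eucl n)} (hA : Convex ℝ A)
    (hAc : IsCompact A) (i : Fin n) (c : ℝ) :
    ρ A = ρ (A ∩ {x | x i ≤ c}) + ρ (A ∩ {x | c ≤ x i}) := by
  rw [← h.cut A hA hAc i c, h.eq_zero_of_subset_flat (Finset.univ.erase i)
    (Finset.erase_ne_self.2 (Finset.mem_univ i)) (fun _ => c) _
    (hA.inter (convex_coord_eq _ _)) (hAc.inter_right (isClosed_coord_eq _ _)), add_zero]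
  intro x hx j hj
  have : j = i := by simpa using hj
  exact this ▸ hx.2

/-- A cut valuation vanishing on all cubes vanishes on all compact convex sets. -/
theorem eq_zero_of_cubes (h : IsCutValuation ρ)
    (hcube : ∀ a : Fin n → ℝ, ∀ l : ℝ, 0 < l → ρ (coordBox a fun _ => l) = 0)
    {K : Set (Eucl n)} (hK : Convex ℝ K) (hKc : IsCompact K) : ρ K = 0 := by
  obtain ⟨B, hB, hbound⟩ := h.bound
  obtain ⟨a, l, hl, hKl⟩ := exists_subset_coordBox hKc
  have hFc : IsCompact (frontier K) := hKc.of_isClosed_subset isClosed_frontier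
    hKc.isClosed.frontier_subset
  have main : ∀ k : ℕ, |ρ K| ≤
      B * volume.real (Metric.cthickening (√n * (l / 2 ^ k)) (frontier K)) := by
    intro k
    set N := Metric.cthickening (√n * (l / 2 ^ k)) (frontier K) with hN
    have hNfin : volume N ≠ ⊤ := hFc.isBounded.cthickening.measure_lt_top.ne
    have := cube_of_small_cubes
      (P := fun a w => |ρ (K ∩ coordBox a w)| ≤ B * volume.real (N ∩ coordBoxIco a w)) ?_ hl k ?_ a
    · rw [inter_eq_left.2 hKl] at this
      refine this.trans ?_
      gcongr
      exact inter_subset_left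
    · intro a w j hw h1 h2
      rw [h.add_of_cut (hK.inter (convex_coordBox a w))
        (hKc.inter_right (isClosed_coordBox a w)) j (a j + w j / 2), inter_assoc, inter_assoc,
        inter_coordBox_le_half a w j (hw j).le, inter_coordBox_ge_half a w j (hw j).le]
      refine (abs_add_le _ _).trans ((add_le_add h1 h2).trans ?_)
      rw [← mul_add]
      gcongr
      exact volume_real_inter_coordBoxIco_halves N hNfin a w j (hw j).le
    · intro a
      have hlk : 0 < l / 2 ^ k := by positivity
      set C := coordBox a (fun _ => l / 2 ^ k) with hCdef
      have hnn : 0 ≤ B * volume.real (N ∩ coordBoxIco a fun _ => l / 2 ^ k) :=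
        mul_nonneg hB measureReal_nonneg
      by_cases hCK : C ⊆ K
      · rwa [inter_eq_right.2 hCK, hcube a _ hlk, abs_zero]
      by_cases hdisj : K ∩ C = ∅
      · rwa [hdisj, h.empty, abs_zero]
      have hCF : (C ∩ frontier K).Nonempty := by
        by_contra hne
        rw [not_nonempty_iff_eq_empty] at hne
        obtain ⟨y, hyK, hyC⟩ := nonempty_iff_ne_empty.2 hdisj
        obtain ⟨z, hzC, hzK⟩ := not_subset.1 hCK
        have hint : ∀ x ∈ C, x ∈ K → x ∈ interior K := fun x hxC hxK => by
          by_contra hx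
          have : x ∈ C ∩ frontier K := ⟨hxC, subset_closure hxK, hx⟩
          rw [hne] at this
          exact this
        obtain ⟨x, -, hx1, hx2⟩ := (convex_coordBox a fun _ => l / 2 ^ k).isPreconnected
          (interior K) Kᶜ isOpen_interior hKc.isClosed.isOpen_compl
          (fun x hx => (em (x ∈ K)).imp (hint x hx) id) ⟨y, hyC, hint y hyC hyK⟩ ⟨z, hzC, hzK⟩
        exact hx2 (interior_subset hx1)
      obtain ⟨y, hyC, hyF⟩ := hCF
      have hsub : coordBoxIco a (fun _ => l / 2 ^ k) ⊆ N := fun x hx =>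
        Metric.mem_cthickening_of_dist_le x y _ _ hyF
          (dist_le_of_mem_coordBox hlk.le (fun i => ⟨(hx i).1, (hx i).2.le⟩) hyC)
      rw [inter_eq_right.2 hsub, volume_real_coordBoxIco a hlk.le]
      exact hbound _ a _ (hK.inter (convex_coordBox _ _)) (hKc.inter_right (isClosed_coordBox _ _))
        hlk inter_subset_right
  have hlim : Tendsto (fun k : ℕ =>
      B * volume.real (Metric.cthickening (√n * (l / 2 ^ k)) (frontier K))) atTop (𝓝 0) := by
    have h0 : Tendsto (fun k : ℕ => √n * (l / (2 : ℝ) ^ k)) atTop (𝓝 0) := by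
      simpa using (tendsto_const_nhds.div_atTop
        (tendsto_pow_atTop_atTop_of_one_lt (one_lt_two (α := ℝ)))).const_mul √n
    have h1 := (tendsto_measure_cthickening_of_isCompact (μ := volume) hFc).comp h0
    rw [hK.addHaar_frontier volume] at h1
    simpa [Measure.real] using ((ENNReal.tendsto_toReal ENNReal.zero_ne_top).comp h1).const_mul B
  exact abs_nonpos_iff.1 (ge_of_tendsto' hlim main)

end IsCutValuation

open Classical in
/-- The extension of a function on convex bodies to all sets, by zero. -/
def extendByZero {n : ℕ} (μ : ConvexBody (Eucl n) → ℝ) (A : Set (Eucl n)) : ℝ :=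
  if h : Convex ℝ A ∧ IsCompact A ∧ A.Nonempty then μ ⟨A, h.1, h.2.1, h.2.2⟩ else 0

section Extension

variable {n : ℕ} {μ : ConvexBody (Eucl n) → ℝ}

theorem extendByZero_coe (K : ConvexBody (Eucl n)) : extendByZero μ K = μ K :=
  dif_pos ⟨K.convex, K.isCompact, K.nonempty⟩

theorem extendByZero_empty : extendByZero μ ∅ = 0 :=
  dif_neg fun h => Set.not_nonempty_empty h.2.2

theorem extendByZero_cut (hval : IsValuation μ) {A : Set (Eucl n)} (hA : Convex ℝ A)
    (hAc : IsCompact A) (i : Fin n) (c : ℝ) :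
    extendByZero μ A + extendByZero μ (A ∩ {x | x i = c}) =
      extendByZero μ (A ∩ {x | x i ≤ c}) + extendByZero μ (A ∩ {x | c ≤ x i}) := by
  rcases (A ∩ {x | x i ≤ c}).eq_empty_or_nonempty with hlo | hlo
  · have h1 : A ∩ {x | x i = c} = ∅ := subset_empty_iff.1
      ((inter_subset_inter_right A fun _ hx => le_of_eq hx).trans hlo.subset)
    have h2 : A ∩ {x | c ≤ x i} = A := inter_eq_left.2 fun x hx => by
      by_contra hlt
      have : x ∈ A ∩ {x | x i ≤ c} := ⟨hx, (not_le.1 (show ¬ c ≤ x i from hlt)).le⟩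
      rw [hlo] at this
      exact this
    rw [hlo, h1, h2, add_comm]
  rcases (A ∩ {x | c ≤ x i}).eq_empty_or_nonempty with hhi | hhi
  · have h1 : A ∩ {x | x i = c} = ∅ := subset_empty_iff.1
      ((inter_subset_inter_right A fun _ hx => ge_of_eq hx).trans hhi.subset)
    have h2 : A ∩ {x | x i ≤ c} = A := inter_eq_left.2 fun x hx => by
      by_contra hlt
      have : x ∈ A ∩ {x | c ≤ x i} := ⟨hx, (not_le.1 (show ¬ x i ≤ c from hlt)).le⟩
      rw [hhi] at this
      exact this
    rw [hhi, h1, h2]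
  have hmid : (A ∩ {x | x i = c}).Nonempty := by
    obtain ⟨x, hx, hxc⟩ := hlo
    obtain ⟨y, hy, hyc⟩ := hhi
    obtain ⟨z, hz, hzc⟩ := hA.isPreconnected.intermediate_value hx hy
      (f := fun x : Eucl n => x i) (by fun_prop) ⟨hxc, hyc⟩
    exact ⟨z, hz, hzc⟩
  have key := hval
    ⟨_, hA.inter (convex_coord_le i c), hAc.inter_right (isClosed_coord_le i c), hlo⟩
    ⟨_, hA.inter (convex_coord_ge i c), hAc.inter_right (isClosed_coord_ge i c), hhi⟩
    ⟨A, hA, hAc, hlo.mono inter_subset_left⟩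
    ⟨_, hA.inter (convex_coord_eq i c), hAc.inter_right (isClosed_coord_eq i c), hmid⟩
    (by
      ext x
      simp only [ConvexBody.coe_mk, mem_union, mem_inter_iff, mem_ofPred_eq, ← and_or_left]
      exact (and_iff_left (le_total _ _)).symm)
    (by
      ext x
      simp only [ConvexBody.coe_mk, mem_inter_iff, mem_ofPred_eq, le_antisymm_iff]
      tauto)
  simpa only [← extendByZero_coe, ConvexBody.coe_mk] using key

theorem extendByZero_bound (hcont : Continuous μ) (htrans : TransInv μ) (hhom : Homog n μ) :
    ∃ B : ℝ, 0 ≤ B ∧ ∀ (A : Set (Eucl n)) (a : Fin n → ℝ) (l : ℝ), Convex ℝ A →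
      IsCompact A → 0 < l → A ⊆ coordBox a (fun _ => l) → |extendByZero μ A| ≤ B * l ^ n := by
  obtain ⟨δ, hδ, hμδ⟩ := Metric.continuousAt_iff.1 (hcont.continuousAt (x := 0)) 1 one_pos
  have hs : 0 < √n + 1 := by positivity
  refine ⟨(|μ 0| + 1) * (2 * (√n + 1) / δ) ^ n, by positivity, ?_⟩
  intro A a l hA hAc hl hAl
  rcases A.eq_empty_or_nonempty with rfl | hne
  · rw [extendByZero_empty, abs_zero]; positivity
  set K : ConvexBody (Eucl n) := ⟨A, hA, hAc, hne⟩ with hK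
  rw [show A = (K : Set (Eucl n)) from rfl, extendByZero_coe]
  set r := δ / (2 * (√n + 1) * l) with hr
  have hrpos : 0 < r := by positivity
  set K' := ConvexBody.dilate r (K.translate (-(WithLp.toLp 2 a))) with hK'
  have hμ : μ K' = r ^ n * μ K := by rw [hK', hhom _ _ hrpos, htrans]
  have hsmall : ∀ x ∈ (K' : Set (Eucl n)), dist x 0 ≤ δ / 2 := by
    rintro x ⟨_, ⟨y, hy, z, hz, rfl⟩, rfl⟩
    rw [mem_singleton_iff] at hz
    have hd := dist_le_of_mem_coordBox hl.le (hAl hy) (y := WithLp.toLp 2 a)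
      (fun i => by simp [hl.le])
    rw [dist_eq_norm] at hd
    simp only [hz, dist_zero_right, norm_smul, Real.norm_of_nonneg hrpos.le, ← sub_eq_add_neg]
    calc r * ‖y - WithLp.toLp 2 a‖ ≤ r * ((√n + 1) * l) := by
          gcongr
          exact hd.trans (by gcongr; linarith)
      _ = δ / 2 := by rw [hr]; field_simp
  have hdist : dist K' 0 < δ := by
    rw [← ConvexBody.hausdorffDist_coe]
    refine (Metric.hausdorffDist_le_of_mem_dist (half_pos hδ).le
      (fun x hx => ⟨0, by simp, hsmall x hx⟩) (fun x hx => ?_)).trans_lt (half_lt_self hδ)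
    obtain ⟨y, hy⟩ := K'.nonempty
    have hx0 : x = 0 := by simpa using hx
    exact ⟨y, hy, by rw [hx0, dist_comm]; exact hsmall y hy⟩
  have h1 : |μ K'| ≤ |μ 0| + 1 := by
    have := hμδ hdist
    rw [Real.dist_eq] at this
    have := abs_sub_abs_le_abs_sub (μ K') (μ 0)
    linarith
  have h2 : μ K = (r ^ n)⁻¹ * μ K' := by rw [hμ]; field_simp
  rw [h2, abs_mul, abs_of_pos (by positivity : 0 < (r ^ n)⁻¹), mul_assoc, ← mul_pow, mul_comm]
  have h3 : (r ^ n)⁻¹ = (2 * (√n + 1) / δ * l) ^ n := by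
    rw [← inv_pow, hr, inv_div]; congr 1; ring
  rw [h3]
  gcongr

theorem extendByZero_cube (htrans : TransInv μ) (hhom : Homog n μ) (a : Fin n → ℝ) {l : ℝ}
    (hl : 0 < l) : extendByZero μ (coordBox a fun _ => l) =
      extendByZero μ (coordBox 0 fun _ => 1) * l ^ n := by
  set K : ConvexBody (Eucl n) := ⟨coordBox 0 fun _ => 1, convex_coordBox _ _,
    isCompact_coordBox _ zero_le_one, ⟨0, fun i => by simp⟩⟩ with hK
  have hset : coordBox a (fun _ => l) =
      ((ConvexBody.dilate l K).translate (WithLp.toLp 2 a) : Set (Eucl n)) := by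
    ext x
    simp only [ConvexBody.translate, ConvexBody.dilate, ConvexBody.coe_mk, add_singleton,
      mem_image, mem_smul_set, hK, coordBox, mem_ofPred_eq]
    constructor
    · intro hx
      refine ⟨_, ⟨l⁻¹ • (x - WithLp.toLp 2 a), fun i => ?_, rfl⟩, ?_⟩
      · have := hx i
        simp only [PiLp.smul_apply, PiLp.sub_apply, smul_eq_mul, Pi.zero_apply, zero_add]
        rw [inv_mul_le_iff₀ hl]
        exact ⟨mul_nonneg (by positivity) (by linarith), by linarith⟩
      · rw [smul_inv_smul₀ hl.ne', sub_add_cancel]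
    · rintro ⟨_, ⟨y, hy, rfl⟩, rfl⟩ i
      have hyi := hy i
      simp only [Pi.zero_apply, zero_add] at hyi
      simp only [PiLp.add_apply, PiLp.smul_apply, smul_eq_mul]
      constructor <;> nlinarith
  rw [hset, extendByZero_coe, htrans, hhom _ _ hl, mul_comm]
  exact congrArg (· * l ^ n) (extendByZero_coe K).symm

theorem isCutValuation_extendByZero_sub_volume (hval : IsValuation μ) (hcont : Continuous μ)
    (htrans : TransInv μ) (hhom : Homog n μ) (c : ℝ) :
    IsCutValuation fun A => extendByZero μ A - c * volume.real A where
  empty := by simp [extendByZero_empty]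
  cut A hA hAc i t := by
    have h := extendByZero_cut hval hA hAc i t
    have hlo : volume (A ∩ {x | x i ≤ t}) ≠ ⊤ :=
      measure_ne_top_of_subset inter_subset_left hAc.measure_ne_top
    have hhi : volume (A ∩ {x | t ≤ x i}) ≠ ⊤ :=
      measure_ne_top_of_subset inter_subset_left hAc.measure_ne_top
    have hv := measureReal_union_add_inter (μ := volume) (s := A ∩ {x | x i ≤ t})
      (hAc.inter_right (isClosed_coord_ge i t)).measurableSet hlo hhi
    have hu : A ∩ {x | x i ≤ t} ∪ A ∩ {x | t ≤ x i} = A := by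
      rw [← inter_union_distrib_left]
      exact inter_eq_left.2 fun x _ => le_total (x i) t
    have hi : A ∩ {x | x i ≤ t} ∩ (A ∩ {x | t ≤ x i}) = A ∩ {x | x i = t} := by
      rw [← inter_inter_distrib_left]
      congr 1
      ext x
      exact (le_antisymm_iff (a := x i) (b := t)).symm
    rw [hu, hi] at hv
    linear_combination h - c * hv
  bound := by
    obtain ⟨B, hB, hbound⟩ := extendByZero_bound hcont htrans hhom
    refine ⟨B + |c|, by positivity, fun A a l hA hAc hl hAl => ?_⟩
    refine (abs_sub _ _).trans ?_
    rw [add_mul, abs_mul, abs_of_nonneg (measureReal_nonneg (s := A))]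
    gcongr
    · exact hbound A a l hA hAc hl hAl
    · rw [← volume_real_coordBox a hl.le]
      exact measureReal_mono hAl (isCompact_coordBox a hl.le).measure_ne_top

end Extension

/-- The space `Val_n` of continuous translation invariant valuations on `ℝⁿ` which are
homogeneous of degree `n` is one-dimensional, spanned by the Lebesgue volume. -/
theorem val_top_degree_spanned_by_volume (n : ℕ) (hn : 1 ≤ n)
    (μ : ConvexBody (Eucl n) → ℝ)
    (hval : IsValuation μ) (hcont : Continuous μ) (htrans : TransInv μ) (hhom : Homog n μ) :
    ∃ c : ℝ, ∀ K : ConvexBody (Eucl n), μ K = c * (volume (K : Set (Eucl n))).toReal := by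
  refine ⟨extendByZero μ (coordBox 0 fun _ => 1), fun K => ?_⟩
  have h := (isCutValuation_extendByZero_sub_volume hval hcont htrans hhom
    (extendByZero μ (coordBox 0 fun _ => 1))).eq_zero_of_cubes (fun a l hl => by
      rw [extendByZero_cube htrans hhom a hl, volume_real_coordBox a hl.le, sub_self])
    K.convex K.isCompact
  rw [extendByZero_coe] at h
  exact sub_eq_zero.1 h
end
end
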